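/- arXiv:2005.05588 — 3 statements merged into one kernel-verified Lean document; each statement's English description precedes it below -/
import Mathlib

section
/- In the maximally entangled case θ=π/2 with pure quantum strategies: (i) $_A(x_A,x_B) ≤ t for all x_A,x_B∈S³; (ii) for every x_B∈S³ there exists x_A∈S³ such that $_A(x_A,x_B) = t. In other words, against any strategy of Bob, Alice has a best response achieving the maximal payoff t (and symmetrically for Bob). -/
open Matrix Kronecker

noncomputable section

/-- Pauli X matrix. -/
def pauliX : Matrix (Fin 2) (Fin 2) ℂ := !![0, 1; 1, 0]
/-- Pauli Y matrix. -/
def pauliY : Matrix (Fin 2) (Fin 2) ℂ := !![0, -Complex.I; Complex.I, 0]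
/-- Pauli Z matrix. -/
def pauliZ : Matrix (Fin 2) (Fin 2) ℂ := !![1, 0; 0, -1]

/-- The entangling operator J = cos(θ/2)·I₄ + i sin(θ/2)·(Y⊗Y). -/
def Jmat (θ : ℝ) : Matrix (Fin 2 × Fin 2) (Fin 2 × Fin 2) ℂ :=
  (Real.cos (θ / 2) : ℂ) • 1 + (Complex.I * Real.sin (θ / 2)) • (pauliY ⊗ₖ pauliY)

/-- The strategy unitary U(x) = α·I + i(β·X + γ·Y + δ·Z) encoded by x = (α,β,γ,δ). -/
def Umat (x : Fin 4 → ℝ) : Matrix (Fin 2) (Fin 2) ℂ :=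
  (x 0 : ℂ) • 1 + Complex.I •
    ((x 1 : ℂ) • pauliX + (x 2 : ℂ) • pauliY + (x 3 : ℂ) • pauliZ)

/-- The initial state |CC⟩. -/
def ketCC : Fin 2 × Fin 2 → ℂ := fun i => if i = (0, 0) then 1 else 0

/-- The final state |ψ⟩ = J†(U(x_A)⊗U(x_B))J|CC⟩. -/
def gameState (θ : ℝ) (xA xB : Fin 4 → ℝ) : Fin 2 × Fin 2 → ℂ :=
  ((Jmat θ)ᴴ * (Umat xA ⊗ₖ Umat xB) * Jmat θ).mulVec ketCC

/-- Alice's payoff: r|⟨CC|ψ⟩|² + s|⟨CD|ψ⟩|² + t|⟨DC|ψ⟩|² + p|⟨DD|ψ⟩|². -/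
def payoffA (t r p s θ : ℝ) (xA xB : Fin 4 → ℝ) : ℝ :=
  r * Complex.normSq (gameState θ xA xB (0, 0))
  + s * Complex.normSq (gameState θ xA xB (0, 1))
  + t * Complex.normSq (gameState θ xA xB (1, 0))
  + p * Complex.normSq (gameState θ xA xB (1, 1))

/-- Bob's payoff: r|⟨CC|ψ⟩|² + t|⟨CD|ψ⟩|² + s|⟨DC|ψ⟩|² + p|⟨DD|ψ⟩|². -/
def payoffB (t r p s θ : ℝ) (xA xB : Fin 4 → ℝ) : ℝ :=
  r * Complex.normSq (gameState θ xA xB (0, 0))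
  + t * Complex.normSq (gameState θ xA xB (0, 1))
  + s * Complex.normSq (gameState θ xA xB (1, 0))
  + p * Complex.normSq (gameState θ xA xB (1, 1))

/-- A pure strategy lies on the unit sphere S³ ⊂ ℝ⁴. -/
def onSphere (x : Fin 4 → ℝ) : Prop :=
  x 0 ^ 2 + x 1 ^ 2 + x 2 ^ 2 + x 3 ^ 2 = 1

/-- Nash equilibrium for the pure-strategy quantum game. -/
def PureNashEq (t r p s θ : ℝ) (xA xB : Fin 4 → ℝ) : Prop :=
  (∀ y, onSphere y → payoffA t r p s θ y xB ≤ payoffA t r p s θ xA xB) ∧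
  (∀ y, onSphere y → payoffB t r p s θ xA y ≤ payoffB t r p s θ xA xB)

/-- At maximal entanglement all four amplitudes of the final state are real. -/
lemma gameState_pi_div_two (xA xB : Fin 4 → ℝ) :
    gameState (Real.pi / 2) xA xB (0, 0)
      = ((xA 0 * xB 0 + xA 1 * xB 2 + xA 2 * xB 1 - xA 3 * xB 3 : ℝ) : ℂ) ∧
    gameState (Real.pi / 2) xA xB (0, 1)
      = ((xA 1 * xB 0 - xA 0 * xB 2 - xA 2 * xB 3 - xA 3 * xB 1 : ℝ) : ℂ) ∧
    gameState (Real.pi / 2) xA xB (1, 0)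
      = ((xA 0 * xB 1 - xA 1 * xB 3 - xA 2 * xB 0 - xA 3 * xB 2 : ℝ) : ℂ) ∧
    gameState (Real.pi / 2) xA xB (1, 1)
      = ((xA 2 * xB 2 - xA 0 * xB 3 - xA 1 * xB 1 - xA 3 * xB 0 : ℝ) : ℂ) := by
  have hsq : ((√2 : ℝ) : ℂ) ^ 2 = 2 := by
    exact_mod_cast Real.sq_sqrt (show (0 : ℝ) ≤ 2 by norm_num)
  have hI : Complex.I ^ 2 = -1 := Complex.I_sq
  have hθ : Real.pi / 2 / 2 = Real.pi / 4 := by ring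
  refine ⟨?_, ?_, ?_, ?_⟩ <;>
  · simp [gameState, Jmat, Umat, ketCC, pauliX, pauliY, pauliZ, hθ, Matrix.mulVec, dotProduct,
      Matrix.mul_apply, Fintype.sum_prod_type, Fin.sum_univ_two, Matrix.one_apply,
      -Complex.ofReal_cos, -Complex.ofReal_sin, Real.cos_pi_div_four, Real.sin_pi_div_four]
    grind

/-- At maximal entanglement the outcome probabilities sum to one. -/
lemma normSq_gameState_sum {xA xB : Fin 4 → ℝ} (hA : onSphere xA) (hB : onSphere xB) :
    Complex.normSq (gameState (Real.pi / 2) xA xB (0, 0))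
    + Complex.normSq (gameState (Real.pi / 2) xA xB (0, 1))
    + Complex.normSq (gameState (Real.pi / 2) xA xB (1, 0))
    + Complex.normSq (gameState (Real.pi / 2) xA xB (1, 1)) = 1 := by
  obtain ⟨h00, h01, h10, h11⟩ := gameState_pi_div_two xA xB
  simp only [h00, h01, h10, h11, Complex.normSq_ofReal, ← sq]
  unfold onSphere at hA hB
  calc _ = (xA 0 ^ 2 + xA 1 ^ 2 + xA 2 ^ 2 + xA 3 ^ 2)
          * (xB 0 ^ 2 + xB 1 ^ 2 + xB 2 ^ 2 + xB 3 ^ 2) := by ring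
    _ = 1 := by rw [hA, hB, one_mul]

lemma weighted_sum_le_of_le {t r p s a b c d : ℝ} (hr : r ≤ t) (hp : p ≤ t) (hs : s ≤ t)
    (ha : 0 ≤ a) (hb : 0 ≤ b) (hd : 0 ≤ d) (h : a + b + c + d = 1) :
    r * a + s * b + t * c + p * d ≤ t := by
  obtain rfl : c = 1 - a - b - d := by linarith
  nlinarith [mul_le_mul_of_nonneg_right hr ha, mul_le_mul_of_nonneg_right hs hb,
    mul_le_mul_of_nonneg_right hp hd]

lemma weighted_sum_eq_of_eq_one {a b c d : ℝ} (t r p s : ℝ)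
    (ha : 0 ≤ a) (hb : 0 ≤ b) (hd : 0 ≤ d) (h : a + b + c + d = 1) (hc : c = 1) :
    r * a + s * b + t * c + p * d = t := by
  obtain rfl : a = 0 := by linarith
  obtain rfl : b = 0 := by linarith
  obtain rfl : d = 0 := by linarith
  simp [hc]

/-- in the maximally entangled case θ = π/2 with pure strategies,
(i) Alice's payoff is at most t; (ii) against any strategy of Bob, Alice has a best
response achieving the maximal payoff t; and symmetrically for Bob. -/
theorem stmt_2 (t r p s : ℝ) (ht : t > r) (hr : r > p) (hp : p > s) (hs : s ≥ 0) :
    (∀ xA xB : Fin 4 → ℝ, onSphere xA → onSphere xB →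
      payoffA t r p s (Real.pi / 2) xA xB ≤ t) ∧
    (∀ xB : Fin 4 → ℝ, onSphere xB → ∃ xA : Fin 4 → ℝ, onSphere xA ∧
      payoffA t r p s (Real.pi / 2) xA xB = t) ∧
    (∀ xA xB : Fin 4 → ℝ, onSphere xA → onSphere xB →
      payoffB t r p s (Real.pi / 2) xA xB ≤ t) ∧
    (∀ xA : Fin 4 → ℝ, onSphere xA → ∃ xB : Fin 4 → ℝ, onSphere xB ∧
      payoffB t r p s (Real.pi / 2) xA xB = t) := by
  refine ⟨fun xA xB hA hB => ?_, fun xB hB => ?_, fun xA xB hA hB => ?_, fun xA hA => ?_⟩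
  · exact weighted_sum_le_of_le (by linarith) (by linarith) (by linarith)
      (Complex.normSq_nonneg _) (Complex.normSq_nonneg _) (Complex.normSq_nonneg _)
      (normSq_gameState_sum hA hB)
  · have hA : onSphere ![xB 1, -xB 3, -xB 0, -xB 2] := by
      simp [onSphere] at hB ⊢
      linarith
    refine ⟨_, hA, weighted_sum_eq_of_eq_one t r p s
      (Complex.normSq_nonneg _) (Complex.normSq_nonneg _) (Complex.normSq_nonneg _)
      (normSq_gameState_sum hA hB) ?_⟩
    rw [(gameState_pi_div_two _ xB).2.2.1, Complex.normSq_ofReal]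
    have h : xB 1 * xB 1 + xB 3 * xB 3 + xB 0 * xB 0 + xB 2 * xB 2 = 1 := by
      unfold onSphere at hB
      linarith
    simp [h]
  · have h := normSq_gameState_sum hA hB
    have := weighted_sum_le_of_le (t := t) (r := r) (p := p) (s := s)
      (by linarith) (by linarith) (by linarith)
      (Complex.normSq_nonneg (gameState (Real.pi / 2) xA xB (0, 0)))
      (Complex.normSq_nonneg (gameState (Real.pi / 2) xA xB (1, 0)))
      (Complex.normSq_nonneg (gameState (Real.pi / 2) xA xB (1, 1)))
      ((congrArg (· + _) (add_right_comm _ _ _)).trans h)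
    unfold payoffB
    linarith
  · have hB : onSphere ![xA 1, -xA 3, -xA 0, -xA 2] := by
      simp [onSphere] at hA ⊢
      linarith
    have hc : Complex.normSq (gameState (Real.pi / 2) xA
        ![xA 1, -xA 3, -xA 0, -xA 2] (0, 1)) = 1 := by
      rw [(gameState_pi_div_two xA _).2.1, Complex.normSq_ofReal]
      have h : xA 1 * xA 1 + xA 0 * xA 0 + xA 2 * xA 2 + xA 3 * xA 3 = 1 := by
        unfold onSphere at hA
        linarith
      simp [h]
    refine ⟨_, hB, ?_⟩
    have h := weighted_sum_eq_of_eq_one t r p s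
      (Complex.normSq_nonneg _) (Complex.normSq_nonneg _) (Complex.normSq_nonneg _)
      ((congrArg (· + _) (add_right_comm _ _ _)).trans (normSq_gameState_sum hA hB)) hc
    unfold payoffB
    linarith
end
end

section
/- In the maximally entangled mixed-strategy game (θ=π/2), if t+s < r+p, then both pairs (p^A*,p^B*) = ((0,1/2,1/2,0),(0,1/2,1/2,0)) and (p^A*,p^B*) = ((1/2,0,0,1/2),(1/2,0,0,1/2)) are Nash equilibria, and at each of these equilibria both players receive average payoff (r+p)/2. -/
open Matrix Real

noncomputable section

/-- The payoff matrix A(θ) of the mixed-strategy quantum prisoner's dilemma,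
with rows/columns indexed by the operators I, X, Y, Z. -/
def Amat (t r p s θ : ℝ) : Matrix (Fin 4) (Fin 4) ℝ :=
  !![r, s * cos θ ^ 2 + t * sin θ ^ 2, s, r * cos θ ^ 2 + p * sin θ ^ 2;
     t * cos θ ^ 2 + s * sin θ ^ 2, p, p * cos θ ^ 2 + r * sin θ ^ 2, t;
     t, p * cos θ ^ 2 + r * sin θ ^ 2, p, t * cos θ ^ 2 + s * sin θ ^ 2;
     r * cos θ ^ 2 + p * sin θ ^ 2, s, s * cos θ ^ 2 + t * sin θ ^ 2, r]

/-- A mixed quantum strategy: a probability vector over {I, X, Y, Z}. -/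
def ProbVec (q : Fin 4 → ℝ) : Prop := (∀ i, 0 ≤ q i) ∧ ∑ i, q i = 1

/-- Alice's expected payoff $_A(p^A, p^B) = (p^A)ᵀ A(θ) p^B. -/
def payA (t r p s θ : ℝ) (pA pB : Fin 4 → ℝ) : ℝ :=
  pA ⬝ᵥ (Amat t r p s θ).mulVec pB

/-- Bob's expected payoff $_B(p^A, p^B) = $_A(p^B, p^A). -/
def payB (t r p s θ : ℝ) (pA pB : Fin 4 → ℝ) : ℝ :=
  payA t r p s θ pB pA

/-- Nash equilibrium of the mixed-strategy quantum game. -/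
def MixedNashEq (t r p s θ : ℝ) (pA pB : Fin 4 → ℝ) : Prop :=
  (∀ q, ProbVec q → payA t r p s θ q pB ≤ payA t r p s θ pA pB) ∧
  (∀ q, ProbVec q → payB t r p s θ pA q ≤ payB t r p s θ pA pB)

/-- Against the even mixture of X and Y, the replies X and Y earn `(r + p) / 2`
and the replies I and Z earn `(t + s) / 2`. -/
theorem payA_pi_div_two_XY (t r p s : ℝ) (q : Fin 4 → ℝ) :
    payA t r p s (π / 2) q ![0, 1/2, 1/2, 0] =
      (q 0 + q 3) * ((t + s) / 2) + (q 1 + q 2) * ((r + p) / 2) := by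
  simp [payA, Amat, dotProduct, mulVec, Fin.sum_univ_four]
  ring

/-- Against the even mixture of I and Z, the replies I and Z earn `(r + p) / 2`
and the replies X and Y earn `(t + s) / 2`. -/
theorem payA_pi_div_two_IZ (t r p s : ℝ) (q : Fin 4 → ℝ) :
    payA t r p s (π / 2) q ![1/2, 0, 0, 1/2] =
      (q 0 + q 3) * ((r + p) / 2) + (q 1 + q 2) * ((t + s) / 2) := by
  simp [payA, Amat, dotProduct, mulVec, Fin.sum_univ_four]
  ring

/-- In this symmetric game, a best reply to itself forms a Nash equilibrium with itself. -/
theorem mixedNashEq_self {t r p s θ : ℝ} {v : Fin 4 → ℝ}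
    (h : ∀ q, ProbVec q → payA t r p s θ q v ≤ payA t r p s θ v v) :
    MixedNashEq t r p s θ v v :=
  ⟨h, h⟩

/-- at θ = π/2, if t+s < r+p, then ((0,1/2,1/2,0),(0,1/2,1/2,0)) and
((1/2,0,0,1/2),(1/2,0,0,1/2)) are Nash equilibria with both payoffs (r+p)/2. -/
theorem stmt_6 (t r p s : ℝ) (ht : t > r) (hr : r > p) (hp : p > s) (hs : s ≥ 0)
    (hts : t + s < r + p) :
    let pXY : Fin 4 → ℝ := ![0, 1/2, 1/2, 0]
    let pIZ : Fin 4 → ℝ := ![1/2, 0, 0, 1/2]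
    (MixedNashEq t r p s (π / 2) pXY pXY ∧
      payA t r p s (π / 2) pXY pXY = (r + p) / 2 ∧
      payB t r p s (π / 2) pXY pXY = (r + p) / 2) ∧
    (MixedNashEq t r p s (π / 2) pIZ pIZ ∧
      payA t r p s (π / 2) pIZ pIZ = (r + p) / 2 ∧
      payB t r p s (π / 2) pIZ pIZ = (r + p) / 2) := by
  intro pXY pIZ
  have hXY : payA t r p s (π / 2) pXY pXY = (r + p) / 2 := by
    rw [payA_pi_div_two_XY]
    simp [pXY]
    ring
  have hIZ : payA t r p s (π / 2) pIZ pIZ = (r + p) / 2 := by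
    rw [payA_pi_div_two_IZ]
    simp [pIZ]
    ring
  refine ⟨⟨mixedNashEq_self fun q hq => ?_, hXY, hXY⟩,
    ⟨mixedNashEq_self fun q hq => ?_, hIZ, hIZ⟩⟩
  all_goals
    obtain ⟨hnn, hsum⟩ := hq
    rw [Fin.sum_univ_four] at hsum
  · rw [hXY, payA_pi_div_two_XY]
    have h03 : q 1 + q 2 = 1 - (q 0 + q 3) := by linarith
    rw [h03]
    nlinarith [mul_nonneg (add_nonneg (hnn 0) (hnn 3)) (sub_nonneg.2 hts.le)]
  · rw [hIZ, payA_pi_div_two_IZ]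
    have h12 : q 0 + q 3 = 1 - (q 1 + q 2) := by linarith
    rw [h12]
    nlinarith [mul_nonneg (add_nonneg (hnn 1) (hnn 2)) (sub_nonneg.2 hts.le)]
end
end

section
/- Suppose t+s < r+p. Then for every θ∈[0,π/2], the pair (p^A*, p^B*) with p^A* = p^B* = (0, 1/2, 1/2, 0) is a Nash equilibrium of the mixed-strategy game with entanglement θ, and at this equilibrium each player's payoff equals (p + p·cos²θ + r·sin²θ)/2. -/
open Matrix Real

noncomputable section

/-- Against the even mixture of X and Y, the payoff depends only on the weights given to
{I, Z} and to {X, Y}. -/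
lemma payA_evenXY (t r p s θ : ℝ) (q : Fin 4 → ℝ) :
    payA t r p s θ q ![0, 1/2, 1/2, 0] =
      (q 0 + q 3) * ((s + s * cos θ ^ 2 + t * sin θ ^ 2) / 2) +
      (q 1 + q 2) * ((p + p * cos θ ^ 2 + r * sin θ ^ 2) / 2) := by
  simp [payA, Amat, Matrix.mulVec, dotProduct, Fin.sum_univ_four]
  ring

/-- Against the even mixture of X and Y, every mixed strategy earns at most what X and Y earn. -/
lemma payA_evenXY_le {t r p s : ℝ} (hp : s ≤ p) (hts : t + s ≤ r + p) (θ : ℝ)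
    {q : Fin 4 → ℝ} (hq : ProbVec q) :
    payA t r p s θ q ![0, 1/2, 1/2, 0] ≤ (p + p * cos θ ^ 2 + r * sin θ ^ 2) / 2 := by
  obtain ⟨hnonneg, hsum⟩ := hq
  rw [Fin.sum_univ_four] at hsum
  have hrow : (s + s * cos θ ^ 2 + t * sin θ ^ 2) / 2 ≤
      (p + p * cos θ ^ 2 + r * sin θ ^ 2) / 2 := by
    have hcos : cos θ ^ 2 = 1 - sin θ ^ 2 := by linarith [sin_sq_add_cos_sq θ]
    have hsin : 0 ≤ 1 - sin θ ^ 2 := hcos ▸ sq_nonneg _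
    rw [hcos]
    nlinarith [mul_nonneg (sub_nonneg.2 hp) hsin,
      mul_nonneg (sub_nonneg.2 hts) (sq_nonneg (sin θ))]
  rw [payA_evenXY, show q 1 + q 2 = 1 - (q 0 + q 3) by linarith]
  nlinarith [mul_le_mul_of_nonneg_left hrow (add_nonneg (hnonneg 0) (hnonneg 3))]

/-- if t+s < r+p, then for every θ ∈ [0, π/2] the pair
((0,1/2,1/2,0),(0,1/2,1/2,0)) is a Nash equilibrium with both payoffs
(p + p·cos²θ + r·sin²θ)/2. -/
theorem stmt_12 (t r p s : ℝ) (ht : t > r) (hr : r > p) (hp : p > s) (hs : s ≥ 0)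
    (hts : t + s < r + p) :
    ∀ θ : ℝ, 0 ≤ θ → θ ≤ π / 2 →
    let pXY : Fin 4 → ℝ := ![0, 1/2, 1/2, 0]
    MixedNashEq t r p s θ pXY pXY ∧
    payA t r p s θ pXY pXY = (p + p * cos θ ^ 2 + r * sin θ ^ 2) / 2 ∧
    payB t r p s θ pXY pXY = (p + p * cos θ ^ 2 + r * sin θ ^ 2) / 2 := by
  intro θ _ _ pXY
  have hval : payA t r p s θ pXY pXY = (p + p * cos θ ^ 2 + r * sin θ ^ 2) / 2 := by
    rw [payA_evenXY]
    simp [pXY]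
    ring
  have hbest : ∀ q, ProbVec q → payA t r p s θ q pXY ≤ payA t r p s θ pXY pXY :=
    fun q hq => hval ▸ payA_evenXY_le hp.le hts.le θ hq
  exact ⟨⟨hbest, hbest⟩, hval, hval⟩
end
end
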